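/- arXiv:2304.10915 — 3 statements merged into one kernel-verified Lean document; each statement's English description precedes it below -/
import Mathlib

section
/- Until-case equivalence for the quasi-flat normal form: let α, γ, β₁, …, βₙ be LTL-formulae. For every team T under lax team semantics: T ⊨ˡ α U (γ ∧ ⋀_{1≤j≤n} ∃βⱼ) if and only if T ⊨ˡ (α U γ) ∧ ⋀_{1≤j≤n} ∃(α U (γ ∧ βⱼ)). -/
namespace TeamLTL

/-- A trace over atomic propositions `AP` is an infinite sequence of sets of propositions. -/
abbrev Trace (AP : Type) := ℕ → Set AP

/-- `t[i,∞]`, the suffix of a trace. -/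
def Trace.suffix {AP : Type} (t : Trace AP) (i : ℕ) : Trace AP := fun j => t (i + j)

/-- A team is a set of traces. -/
abbrev Team (AP : Type) := Set (Trace AP)

/-- `T[f,∞] = { t[s,∞] : t ∈ T, s ∈ f t }` for `f : T → P(ℕ)⁺`. -/
def Team.update {AP : Type} (T : Team AP) (f : Trace AP → Set ℕ) : Team AP :=
  { s | ∃ t ∈ T, ∃ i ∈ f t, s = Trace.suffix t i }

/-- `f` maps every trace of `T` to a nonempty set of naturals (i.e. `f : T → P(ℕ)⁺`). -/
def properOn {AP : Type} (T : Team AP) (f : Trace AP → Set ℕ) : Prop :=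
  ∀ t ∈ T, (f t).Nonempty

/-- `f' < f` on the team `T'`: for all `t ∈ T'`, `min (f' t) ≤ min (f t)` and whenever
`f t` has a maximum, `f' t` has a maximum which is strictly smaller. -/
def funLT {AP : Type} (T' : Team AP) (f' f : Trace AP → Set ℕ) : Prop :=
  ∀ t ∈ T', sInf (f' t) ≤ sInf (f t) ∧
    ∀ m, IsGreatest (f t) m → ∃ m', IsGreatest (f' t) m' ∧ m' < m

/-- Formulae of TeamLTL, together with the Boolean disjunction `bor` (⊽) and the
Boolean negation `bneg` (∼).  Plain TeamLTL-formulae (= LTL-formulae in negation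
normal form) are those satisfying `isLTL` below. -/
inductive Formula (AP : Type) : Type
  | atom  : AP → Formula AP
  | natom : AP → Formula AP
  | conj  : Formula AP → Formula AP → Formula AP
  | disj  : Formula AP → Formula AP → Formula AP
  | next  : Formula AP → Formula AP
  | glob  : Formula AP → Formula AP
  | untl  : Formula AP → Formula AP → Formula AP
  | bor   : Formula AP → Formula AP → Formula AP
  | bneg  : Formula AP → Formula AP

/-- Lax team semantics `T ⊨ˡ φ`. -/
def laxSat {AP : Type} : Formula AP → Team AP → Prop
  | .atom p, T => ∀ t ∈ T, p ∈ t 0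
  | .natom p, T => ∀ t ∈ T, p ∉ t 0
  | .conj φ ψ, T => laxSat φ T ∧ laxSat ψ T
  | .disj φ ψ, T => ∃ T₁ T₂ : Team AP, T = T₁ ∪ T₂ ∧ laxSat φ T₁ ∧ laxSat ψ T₂
  | .next φ, T => laxSat φ (Team.update T (fun _ => {1}))
  | .glob φ, T => ∀ f, properOn T f → laxSat φ (Team.update T f)
  | .untl φ ψ, T => ∃ f, properOn T f ∧ laxSat ψ (Team.update T f) ∧
      ({t ∈ T | f t ≠ ({0} : Set ℕ)} = ∅ ∨
        ∀ f', properOn {t ∈ T | f t ≠ ({0} : Set ℕ)} f' →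
          funLT {t ∈ T | f t ≠ ({0} : Set ℕ)} f' f →
          laxSat φ (Team.update {t ∈ T | f t ≠ ({0} : Set ℕ)} f'))
  | .bor φ ψ, T => laxSat φ T ∨ laxSat ψ T
  | .bneg φ, T => ¬ laxSat φ T

/-- Classical LTL semantics on a single trace. -/
def traceSat {AP : Type} : Formula AP → Trace AP → Prop
  | .atom p, t => p ∈ t 0
  | .natom p, t => p ∉ t 0
  | .conj φ ψ, t => traceSat φ t ∧ traceSat ψ t
  | .disj φ ψ, t => traceSat φ t ∨ traceSat ψ t
  | .next φ, t => traceSat φ (Trace.suffix t 1)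
  | .glob φ, t => ∀ i, traceSat φ (Trace.suffix t i)
  | .untl φ ψ, t => ∃ i, traceSat ψ (Trace.suffix t i) ∧ ∀ j < i, traceSat φ (Trace.suffix t j)
  | .bor φ ψ, t => traceSat φ t ∨ traceSat ψ t
  | .bneg φ, t => ¬ traceSat φ t

/-- `φ` is a plain LTL-formula (no ⊽ and no ∼). -/
def Formula.isLTL {AP : Type} : Formula AP → Prop
  | .atom _ => True
  | .natom _ => True
  | .conj φ ψ => φ.isLTL ∧ ψ.isLTL
  | .disj φ ψ => φ.isLTL ∧ ψ.isLTL
  | .next φ => φ.isLTL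
  | .glob φ => φ.isLTL
  | .untl φ ψ => φ.isLTL ∧ ψ.isLTL
  | .bor _ _ => False
  | .bneg _ => False

/-- `φ` is a TeamLTL(⊽)-formula (no Boolean negation ∼). -/
def Formula.noBneg {AP : Type} : Formula AP → Prop
  | .atom _ => True
  | .natom _ => True
  | .conj φ ψ => φ.noBneg ∧ ψ.noBneg
  | .disj φ ψ => φ.noBneg ∧ ψ.noBneg
  | .next φ => φ.noBneg
  | .glob φ => φ.noBneg
  | .untl φ ψ => φ.noBneg ∧ ψ.noBneg
  | .bor φ ψ => φ.noBneg ∧ ψ.noBneg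
  | .bneg _ => False

/-- `φ` is a TeamLTL(∼)-formula (no Boolean disjunction ⊽). -/
def Formula.noBor {AP : Type} : Formula AP → Prop
  | .atom _ => True
  | .natom _ => True
  | .conj φ ψ => φ.noBor ∧ ψ.noBor
  | .disj φ ψ => φ.noBor ∧ ψ.noBor
  | .next φ => φ.noBor
  | .glob φ => φ.noBor
  | .untl φ ψ => φ.noBor ∧ ψ.noBor
  | .bor _ _ => False
  | .bneg φ => φ.noBor

/-- Left-flatness: in every subformula `G ψ` and `ψ U θ`, `ψ` is an LTL-formula;
moreover `φ` is a TeamLTL(⊽)-formula (no ∼). -/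
def Formula.leftFlat {AP : Type} : Formula AP → Prop
  | .atom _ => True
  | .natom _ => True
  | .conj φ ψ => φ.leftFlat ∧ ψ.leftFlat
  | .disj φ ψ => φ.leftFlat ∧ ψ.leftFlat
  | .next φ => φ.leftFlat
  | .glob φ => φ.isLTL
  | .untl φ ψ => φ.isLTL ∧ ψ.leftFlat
  | .bor φ ψ => φ.leftFlat ∧ ψ.leftFlat
  | .bneg _ => False

/-- Left-downward closure: in every subformula `G ψ` and `ψ U θ`, `ψ` is a
TeamLTL(⊽)-formula (contains no ∼). -/
def Formula.leftDC {AP : Type} : Formula AP → Prop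
  | .atom _ => True
  | .natom _ => True
  | .conj φ ψ => φ.leftDC ∧ ψ.leftDC
  | .disj φ ψ => φ.leftDC ∧ ψ.leftDC
  | .next φ => φ.leftDC
  | .glob φ => φ.noBneg
  | .untl φ ψ => φ.noBneg ∧ ψ.leftDC
  | .bor φ ψ => φ.leftDC ∧ ψ.leftDC
  | .bneg φ => φ.leftDC

/-- Length (size) of a formula. -/
def Formula.size {AP : Type} : Formula AP → ℕ
  | .atom _ => 1
  | .natom _ => 1
  | .conj φ ψ => φ.size + ψ.size + 1
  | .disj φ ψ => φ.size + ψ.size + 1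
  | .next φ => φ.size + 1
  | .glob φ => φ.size + 1
  | .untl φ ψ => φ.size + ψ.size + 1
  | .bor φ ψ => φ.size + ψ.size + 1
  | .bneg φ => φ.size + 1

/-- Number of occurrences of the Boolean disjunction ⊽ in a formula. -/
def Formula.borCount {AP : Type} : Formula AP → ℕ
  | .atom _ => 0
  | .natom _ => 0
  | .conj φ ψ => φ.borCount + ψ.borCount
  | .disj φ ψ => φ.borCount + ψ.borCount
  | .next φ => φ.borCount
  | .glob φ => φ.borCount
  | .untl φ ψ => φ.borCount + ψ.borCount
  | .bor φ ψ => φ.borCount + ψ.borCount + 1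
  | .bneg φ => φ.borCount

/-- Boolean disjunction `⊽` of a nonempty list of formulae (head plus tail). -/
def disjOf {AP : Type} : Formula AP → List (Formula AP) → Formula AP
  | a, [] => a
  | a, b :: l => .bor a (disjOf b l)

/-- Conjunction `a ∧ ⋀ l` of a formula with a (possibly empty) list of formulae. -/
def conjAnd {AP : Type} (a : Formula AP) : List (Formula AP) → Formula AP
  | [] => a
  | b :: l => .conj (conjAnd a l) b

/-- Some atomic proposition occurring in a formula. -/
def Formula.someAtom {AP : Type} : Formula AP → AP
  | .atom p => p
  | .natom p => p
  | .conj φ _ => φ.someAtom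
  | .disj φ _ => φ.someAtom
  | .next φ => φ.someAtom
  | .glob φ => φ.someAtom
  | .untl φ _ => φ.someAtom
  | .bor φ _ => φ.someAtom
  | .bneg φ => φ.someAtom

/-- The dual `φ^d`: the negation normal form of `¬φ` (for LTL-formulae `φ`).
`¬Gφ` is rewritten as `⊤ U ¬φ` and `¬(φUψ)` as `(¬ψ U (¬φ ∧ ¬ψ)) ∨ G¬ψ`. -/
def Formula.dual {AP : Type} : Formula AP → Formula AP
  | .atom p => .natom p
  | .natom p => .atom p
  | .conj φ ψ => .disj φ.dual ψ.dual
  | .disj φ ψ => .conj φ.dual ψ.dual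
  | .next φ => .next φ.dual
  | .glob φ => .untl (.disj (.atom φ.someAtom) (.natom φ.someAtom)) φ.dual
  | .untl φ ψ => .disj (.untl ψ.dual (.conj φ.dual ψ.dual)) (.glob ψ.dual)
  | .bor φ ψ => .conj φ.dual ψ.dual
  | .bneg φ => φ

/-- `∃β`, an abbreviation for `∼β^d`: it holds in a team `T` iff some trace of `T`
satisfies `β` classically. -/
def Formula.exi {AP : Type} (β : Formula AP) : Formula AP := .bneg β.dual

end TeamLTL

namespace TeamLTL

/-- `φ` is flat: a team satisfies it iff each of its traces does classically. -/
def Formula.IsFlat {AP : Type} (φ : Formula AP) : Prop :=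
  ∀ T : Team AP, laxSat φ T ↔ ∀ t ∈ T, traceSat φ t

theorem forall_mem_update {AP : Type} {T : Team AP} {f : Trace AP → Set ℕ}
    {P : Trace AP → Prop} :
    (∀ s ∈ T.update f, P s) ↔ ∀ t ∈ T, ∀ i ∈ f t, P (t.suffix i) :=
  ⟨fun h t ht i hi => h _ ⟨t, ht, i, hi, rfl⟩, by rintro h _ ⟨t, ht, i, hi, rfl⟩; exact h t ht i hi⟩

theorem exists_mem_update {AP : Type} {T : Team AP} {f : Trace AP → Set ℕ}
    {P : Trace AP → Prop} :
    (∃ s ∈ T.update f, P s) ↔ ∃ t ∈ T, ∃ i ∈ f t, P (t.suffix i) :=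
  ⟨by rintro ⟨_, ⟨t, ht, i, hi, rfl⟩, h⟩; exact ⟨t, ht, i, hi, h⟩,
    fun ⟨t, ht, i, hi, h⟩ => ⟨_, ⟨t, ht, i, hi, rfl⟩, h⟩⟩

/-- For flat `α`, the guard of `α U ψ` at `f` says that `α` holds classically strictly before
every position chosen by `f`. -/
theorem until_guard_iff {AP : Type} {α : Formula AP} (hα : α.IsFlat) {T : Team AP}
    {f : Trace AP → Set ℕ} (hf : properOn T f) :
    ({t ∈ T | f t ≠ ({0} : Set ℕ)} = ∅ ∨
        ∀ f', properOn {t ∈ T | f t ≠ ({0} : Set ℕ)} f' →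
          funLT {t ∈ T | f t ≠ ({0} : Set ℕ)} f' f →
          laxSat α (Team.update {t ∈ T | f t ≠ ({0} : Set ℕ)} f')) ↔
      ∀ t ∈ T, ∀ i ∈ f t, ∀ j < i, traceSat α (t.suffix j) := by
  classical
  constructor
  · intro h t ht i hi j hj
    have hne : f t ≠ {0} := by
      intro h0
      rw [h0] at hi
      simp only [Set.mem_singleton_iff] at hi
      omega
    rcases h with h | h
    · exact absurd (show t ∈ {t ∈ T | f t ≠ ({0} : Set ℕ)} from ⟨ht, hne⟩) (by simp [h])
    have hmin : ∀ n : ℕ, sInf ({0, n} : Set ℕ) = 0 := fun n =>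
      Nat.sInf_eq_zero.2 (Or.inl (by simp))
    have key := h (fun s => if s = t then {0, j} else {0})
      (fun s _ => by dsimp only; split_ifs <;> simp)
      (by
        rintro s ⟨hs, hs0⟩
        dsimp only
        split_ifs with hst
        · subst hst
          refine ⟨by simp [hmin], fun m hm => ⟨j, ⟨by simp, ?_⟩, hj.trans_le (hm.2 hi)⟩⟩
          rintro x (rfl | rfl) <;> omega
        · refine ⟨by simp, fun m hm => ⟨0, isGreatest_singleton, ?_⟩⟩
          rw [Nat.pos_iff_ne_zero]
          rintro rfl
          apply hs0
          ext x
          constructor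
          · intro hx
            exact Nat.le_zero.1 (hm.2 hx)
          · rintro rfl
            exact hm.1)
    rw [hα, forall_mem_update] at key
    exact key t ⟨ht, hne⟩ j (by simp)
  · intro h
    refine Or.inr fun f' _ hlt => ?_
    rw [hα, forall_mem_update]
    rintro t ⟨ht, ht0⟩ j hj
    by_cases hb : BddAbove (f t)
    · have hm : IsGreatest (f t) (sSup (f t)) :=
        ⟨Nat.sSup_mem (hf t ht) hb, fun _ hx => le_csSup hb hx⟩
      obtain ⟨m', hm', hlt'⟩ := (hlt t ⟨ht, ht0⟩).2 _ hm
      exact h t ht _ hm.1 j ((hm'.2 hj).trans_lt hlt')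
    · obtain ⟨i, hi, hji⟩ := not_bddAbove_iff.1 hb j
      exact h t ht i hi j hji

theorem laxSat_untl_iff {AP : Type} {α : Formula AP} (hα : α.IsFlat) (ψ : Formula AP)
    (T : Team AP) :
    laxSat (.untl α ψ) T ↔ ∃ f, properOn T f ∧ laxSat ψ (T.update f) ∧
      ∀ t ∈ T, ∀ i ∈ f t, ∀ j < i, traceSat α (t.suffix j) :=
  exists_congr fun _ => and_congr_right fun hf => and_congr_right fun _ => until_guard_iff hα hf

theorem Formula.IsFlat.untl {AP : Type} {α γ : Formula AP} (hα : α.IsFlat) (hγ : γ.IsFlat) :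
    (Formula.untl α γ).IsFlat := by
  intro T
  rw [laxSat_untl_iff hα]
  simp only [hγ _, forall_mem_update, traceSat]
  constructor
  · rintro ⟨f, hf, hγf, hαf⟩ t ht
    obtain ⟨i, hi⟩ := hf t ht
    exact ⟨i, hγf t ht i hi, hαf t ht i hi⟩
  · intro h
    exact ⟨fun t => {i | traceSat γ (t.suffix i) ∧ ∀ j < i, traceSat α (t.suffix j)}, h,
      fun _ _ _ hi => hi.1, fun _ _ _ hi => hi.2⟩

theorem Formula.isLTL.isFlat {AP : Type} {φ : Formula AP} (hφ : φ.isLTL) : φ.IsFlat := by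
  induction φ with
  | atom p => exact fun T => Iff.rfl
  | natom p => exact fun T => Iff.rfl
  | conj φ ψ ih₁ ih₂ =>
    intro T
    simp only [laxSat, traceSat, ih₁ hφ.1 T, ih₂ hφ.2 T]
    exact ⟨fun h t ht => ⟨h.1 t ht, h.2 t ht⟩, fun h => ⟨fun t ht => (h t ht).1,
      fun t ht => (h t ht).2⟩⟩
  | disj φ ψ ih₁ ih₂ =>
    intro T
    simp only [laxSat, traceSat, ih₁ hφ.1 _, ih₂ hφ.2 _]
    constructor
    · rintro ⟨T₁, T₂, rfl, h₁, h₂⟩ t (ht | ht)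
      · exact Or.inl (h₁ t ht)
      · exact Or.inr (h₂ t ht)
    · intro h
      refine ⟨{t ∈ T | traceSat φ t}, {t ∈ T | traceSat ψ t}, ?_, fun t ht => ht.2,
        fun t ht => ht.2⟩
      ext t
      constructor
      · intro ht
        exact (h t ht).imp (fun h => ⟨ht, h⟩) (fun h => ⟨ht, h⟩)
      · rintro (ht | ht) <;> exact ht.1
  | next φ ih =>
    intro T
    simp [laxSat, traceSat, ih hφ _, forall_mem_update]
  | glob φ ih =>
    intro T
    simp only [laxSat, traceSat, ih hφ _, forall_mem_update]
    exact ⟨fun h t ht i => h (fun _ => {i}) (fun _ _ => Set.singleton_nonempty i) t ht i rfl,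
      fun h f _ t ht i _ => h t ht i⟩
  | untl φ ψ ih₁ ih₂ => exact (ih₁ hφ.1).untl (ih₂ hφ.2)
  | bor => exact hφ.elim
  | bneg => exact hφ.elim

theorem Formula.isLTL.dual {AP : Type} {φ : Formula AP} (hφ : φ.isLTL) : φ.dual.isLTL := by
  induction φ with
  | bor => exact hφ.elim
  | bneg => exact hφ.elim
  | _ => simp_all [Formula.isLTL, Formula.dual]

theorem traceSat_dual {AP : Type} {φ : Formula AP} (hφ : φ.isLTL) (t : Trace AP) :
    traceSat φ.dual t ↔ ¬ traceSat φ t := by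
  induction φ generalizing t with
  | atom p => rfl
  | natom p => simp [Formula.dual, traceSat]
  | conj φ ψ ih₁ ih₂ => simp only [Formula.dual, traceSat, ih₁ hφ.1, ih₂ hφ.2]; tauto
  | disj φ ψ ih₁ ih₂ => simp only [Formula.dual, traceSat, ih₁ hφ.1, ih₂ hφ.2]; tauto
  | next φ ih => exact ih hφ _
  | glob φ ih =>
    simp only [Formula.dual, traceSat, ih hφ, not_forall]
    exact exists_congr fun i => and_iff_left fun _ _ => em _
  | untl φ ψ ih₁ ih₂ =>
    classical
    simp only [Formula.dual, traceSat, ih₁ hφ.1, ih₂ hφ.2]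
    constructor
    · rintro (⟨i, ⟨hφi, hψi⟩, hlt⟩ | h) ⟨k, hψk, hφk⟩
      · rcases lt_trichotomy k i with hki | rfl | hik
        · exact hlt k hki hψk
        · exact hψi hψk
        · exact hφi (hφk i hik)
      · exact h k hψk
    · intro h
      by_cases hex : ∃ k, traceSat ψ (t.suffix k)
      · left
        have hmin := fun j (hj : j < Nat.find hex) => Nat.find_min hex hj
        have : ∃ i < Nat.find hex, ¬ traceSat φ (t.suffix i) := by
          by_contra! hall
          exact h ⟨_, Nat.find_spec hex, hall⟩
        obtain ⟨i, hi, hφi⟩ := this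
        exact ⟨i, ⟨hφi, hmin i hi⟩, fun j hj => hmin j (hj.trans hi)⟩
      · exact Or.inr (not_exists.1 hex)
  | bor => exact hφ.elim
  | bneg => exact hφ.elim

theorem laxSat_exi {AP : Type} {β : Formula AP} (hβ : β.isLTL) (T : Team AP) :
    laxSat β.exi T ↔ ∃ t ∈ T, traceSat β t := by
  simp only [Formula.exi, laxSat, hβ.dual.isFlat T, traceSat_dual hβ]
  push Not
  rfl

theorem laxSat_conjAnd {AP : Type} (a : Formula AP) (l : List (Formula AP)) (T : Team AP) :
    laxSat (conjAnd a l) T ↔ laxSat a T ∧ ∀ b ∈ l, laxSat b T := by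
  induction l with
  | nil => simp [conjAnd]
  | cons b l ih =>
    simp only [conjAnd, laxSat, ih, List.forall_mem_cons]
    tauto

/-- Until-case equivalence for the quasi-flat normal form: for LTL-formulae
`α`, `γ`, `β₁, …, βₙ` and every team `T`,
`T ⊨ˡ α U (γ ∧ ⋀ⱼ ∃βⱼ)` iff `T ⊨ˡ (α U γ) ∧ ⋀ⱼ ∃(α U (γ ∧ βⱼ))`. -/
theorem until_case_of_quasi_flat_nf {AP : Type} (α γ : Formula AP)
    (βs : List (Formula AP)) (hα : α.isLTL) (hγ : γ.isLTL)
    (hβ : ∀ β ∈ βs, β.isLTL) (T : Team AP) :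
    laxSat (Formula.untl α (conjAnd γ (βs.map Formula.exi))) T ↔
      laxSat (conjAnd (Formula.untl α γ)
        (βs.map fun β => Formula.exi (Formula.untl α (Formula.conj γ β)))) T := by
  rw [laxSat_untl_iff hα.isFlat, laxSat_conjAnd, (hα.isFlat.untl hγ.isFlat) T]
  simp only [laxSat_conjAnd, List.forall_mem_map, hγ.isFlat _, forall_mem_update]
  constructor
  · rintro ⟨f, hf, ⟨hγf, hβf⟩, hαf⟩
    refine ⟨fun t ht => ?_, fun β hmem => ?_⟩
    · obtain ⟨i, hi⟩ := hf t ht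
      exact ⟨i, hγf t ht i hi, hαf t ht i hi⟩
    · obtain ⟨t, ht, i, hi, hβi⟩ :=
        exists_mem_update.1 ((laxSat_exi (hβ β hmem) _).1 (hβf β hmem))
      exact (laxSat_exi (β := .untl α (.conj γ β)) ⟨hα, hγ, hβ β hmem⟩ T).2
        ⟨t, ht, i, ⟨hγf t ht i hi, hβi⟩, hαf t ht i hi⟩
  · rintro ⟨hU, hE⟩
    refine ⟨fun t => {i | traceSat γ (t.suffix i) ∧ ∀ j < i, traceSat α (t.suffix j)}, hU,
      ⟨fun _ _ _ hi => hi.1, fun β hmem => ?_⟩, fun _ _ _ hi => hi.2⟩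
    obtain ⟨t, ht, i, ⟨hγi, hβi⟩, hαi⟩ :=
      (laxSat_exi (β := .untl α (.conj γ β)) ⟨hα, hγ, hβ β hmem⟩ T).1 (hE β hmem)
    exact (laxSat_exi (hβ β hmem) _).2 (exists_mem_update.2 ⟨t, ht, i, ⟨hγi, hαi⟩, hβi⟩)

end TeamLTL
end

section
/- The quasi-flat normal form fails for formulae that are not left-downward closed: let p₁, p₂ be distinct atomic propositions and t the trace with t[2i] = {p₁} and t[2i+1] = {p₂} for all i ∈ ℕ. Then {t} ⊨ˡ G(∃p₁ ⊽ ∃p₂), but {t} ⊭ˡ G∃p₁ and {t} ⊭ˡ G∃p₂. -/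
namespace TeamLTL

/-- An update of a singleton team `{t}` satisfies `∃p` iff `p` holds at a selected position of `t`. -/
theorem laxSat_exi_atom_update_singleton {AP : Type} (p : AP) (t : Trace AP)
    (f : Trace AP → Set ℕ) :
    laxSat (Formula.exi (.atom p)) (Team.update {t} f) ↔ ∃ i ∈ f t, p ∈ t i := by
  simp [Formula.exi, Formula.dual, laxSat, Team.update, Trace.suffix]

/-- The quasi-flat normal form fails for formulae that are not left-downward
closed: for the trace `t = ({p₁}{p₂})^ω`, `{t} ⊨ˡ G(∃p₁ ⊽ ∃p₂)` but
`{t} ⊭ˡ G∃p₁` and `{t} ⊭ˡ G∃p₂`.  (Here `∃p` is `∼¬p = bneg (natom p)`.) -/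
theorem quasi_flat_nf_fails_without_leftDC {AP : Type} (p₁ p₂ : AP)
    (hp : p₁ ≠ p₂) (t : Trace AP)
    (ht : ∀ i, t (2 * i) = {p₁} ∧ t (2 * i + 1) = {p₂}) :
    laxSat (Formula.glob (.bor (Formula.exi (.atom p₁))
        (Formula.exi (.atom p₂)))) ({t} : Team AP) ∧
    ¬ laxSat (Formula.glob (Formula.exi (.atom p₁))) ({t} : Team AP) ∧
    ¬ laxSat (Formula.glob (Formula.exi (.atom p₂))) ({t} : Team AP) := by
  refine ⟨fun f hf => ?_, fun h => ?_, fun h => ?_⟩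
  · obtain ⟨i, hi⟩ := hf t rfl
    obtain ⟨k, rfl | rfl⟩ := i.even_or_odd'
    · exact Or.inl ((laxSat_exi_atom_update_singleton p₁ t f).2 ⟨_, hi, by simp [(ht k).1]⟩)
    · exact Or.inr ((laxSat_exi_atom_update_singleton p₂ t f).2 ⟨_, hi, by simp [(ht k).2]⟩)
  · obtain ⟨i, rfl, hi⟩ := (laxSat_exi_atom_update_singleton p₁ t _).1
      (h (fun _ => {1}) fun _ _ => Set.singleton_nonempty 1)
    rw [show t 1 = {p₂} from (ht 0).2] at hi
    exact hp hi
  · obtain ⟨i, rfl, hi⟩ := (laxSat_exi_atom_update_singleton p₂ t _).1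
      (h (fun _ => {0}) fun _ _ => Set.singleton_nonempty 0)
    rw [show t 0 = {p₁} from (ht 0).1] at hi
    exact hp hi.symm

end TeamLTL
end

section
/- Over infinite teams, asynchronous until and TeamCTL's U_∃ differ: let p, q be distinct atomic propositions and, for each k ∈ ℕ, let t_k be the trace with t_k[i] = {p} for i < k and t_k[i] = {q} for i ≥ k. Then the team T := { t_k : k ∈ ℕ } satisfies p U q under lax asynchronous team semantics, but the multiteam { (k, t_k) : k ∈ ℕ } does not satisfy [p U_∃ q] under TeamCTL semantics. -/
namespace TeamLTL

/-- A multiteam is a set of index–trace pairs. -/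
abbrev MultiTeam (ι : Type) (AP : Type) := Set (ι × Trace AP)

/-- `T[f,∞] = { (i, t[f(i,t),∞]) : (i,t) ∈ T }` for `f : T → ℕ`. -/
def MultiTeam.update {ι AP : Type} (T : MultiTeam ι AP) (f : ι × Trace AP → ℕ) :
    MultiTeam ι AP :=
  { x | ∃ y ∈ T, x = (y.1, Trace.suffix y.2 (f y)) }

/-- The support of a multiteam: the set of traces occurring in it. -/
def MultiTeam.support {ι AP : Type} (T : MultiTeam ι AP) : Team AP :=
  { t | ∃ i, (i, t) ∈ T }

/-- Strict asynchronous team semantics `T ⊨ φ` on multiteams. -/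
def strictSat {ι AP : Type} : Formula AP → MultiTeam ι AP → Prop
  | .atom p, T => ∀ x ∈ T, p ∈ x.2 0
  | .natom p, T => ∀ x ∈ T, p ∉ x.2 0
  | .conj φ ψ, T => strictSat φ T ∧ strictSat ψ T
  | .disj φ ψ, T => ∃ T₁ T₂ : MultiTeam ι AP,
      T = T₁ ∪ T₂ ∧ T₁ ∩ T₂ = ∅ ∧ strictSat φ T₁ ∧ strictSat ψ T₂
  | .next φ, T => strictSat φ (MultiTeam.update T (fun _ => 1))
  | .glob φ, T => ∀ f, strictSat φ (MultiTeam.update T f)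
  | .untl φ ψ, T => ∃ f, strictSat ψ (MultiTeam.update T f) ∧
      ∀ f', (∀ x ∈ {x ∈ T | f x ≠ 0}, f' x < f x) →
        strictSat φ (MultiTeam.update {x ∈ T | f x ≠ 0} f')
  | .bor φ ψ, T => strictSat φ T ∨ strictSat ψ T
  | .bneg φ, T => ¬ strictSat φ T

end TeamLTL
namespace TeamLTL

/-- `τ` is a time evaluation function (tef) for the multiteam `T`:
stepwise and strictly monotone. -/
def IsTef {ι AP : Type} (T : MultiTeam ι AP) (τ : ℕ → ι × Trace AP → ℕ) : Prop :=
  (∀ i, ∀ x ∈ T, τ (i + 1) x = τ i x ∨ τ (i + 1) x = τ i x + 1) ∧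
  (∀ i, ∃ x ∈ T, τ (i + 1) x ≠ τ i x)

/-- `τ` is an initial tef for `T`. -/
def IsInitialTef {ι AP : Type} (T : MultiTeam ι AP) (τ : ℕ → ι × Trace AP → ℕ) : Prop :=
  IsTef T τ ∧ ∀ x ∈ T, τ 0 x = 0

/-- Formulae of TeamCTL(X, G_∀, M_∃, ⊽): literals, ∧, ∨, ⊽, the synchronous next `X`,
`G_∀`, and the strong release `[θ M_∃ ψ] := [ψ U_∃ (ψ ∧ θ)]` (constructor `srelE θ ψ`). -/
inductive CTLFormula (AP : Type) : Type
  | atom  : AP → CTLFormula AP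
  | natom : AP → CTLFormula AP
  | conj  : CTLFormula AP → CTLFormula AP → CTLFormula AP
  | disj  : CTLFormula AP → CTLFormula AP → CTLFormula AP
  | bor   : CTLFormula AP → CTLFormula AP → CTLFormula AP
  | next  : CTLFormula AP → CTLFormula AP
  | globA : CTLFormula AP → CTLFormula AP
  | srelE : CTLFormula AP → CTLFormula AP → CTLFormula AP

/-- TeamCTL semantics on multiteams.  `srelE θ ψ` is `[θ M_∃ ψ] = [ψ U_∃ (ψ ∧ θ)]`. -/
def ctlSat {ι AP : Type} : CTLFormula AP → MultiTeam ι AP → Prop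
  | .atom p, T => ∀ x ∈ T, p ∈ x.2 0
  | .natom p, T => ∀ x ∈ T, p ∉ x.2 0
  | .conj φ ψ, T => ctlSat φ T ∧ ctlSat ψ T
  | .disj φ ψ, T => ∃ T₁ T₂ : MultiTeam ι AP,
      T = T₁ ∪ T₂ ∧ T₁ ∩ T₂ = ∅ ∧ ctlSat φ T₁ ∧ ctlSat ψ T₂
  | .bor φ ψ, T => ctlSat φ T ∨ ctlSat ψ T
  | .next φ, T => ctlSat φ (MultiTeam.update T (fun _ => 1))
  | .globA φ, T => ∀ τ, IsInitialTef T τ → ∀ k, ctlSat φ (MultiTeam.update T (τ k))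
  | .srelE θ ψ, T => ∃ τ, IsInitialTef T τ ∧ ∃ k,
      (ctlSat ψ (MultiTeam.update T (τ k)) ∧ ctlSat θ (MultiTeam.update T (τ k))) ∧
      ∀ m < k, ctlSat ψ (MultiTeam.update T (τ m))

/-- A TeamCTL-formula containing no Boolean disjunction ⊽ ("an LTL-formula"). -/
def CTLFormula.isFlat {AP : Type} : CTLFormula AP → Prop
  | .atom _ => True
  | .natom _ => True
  | .conj φ ψ => φ.isFlat ∧ ψ.isFlat
  | .disj φ ψ => φ.isFlat ∧ ψ.isFlat
  | .bor _ _ => False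
  | .next φ => φ.isFlat
  | .globA φ => φ.isFlat
  | .srelE θ ψ => θ.isFlat ∧ ψ.isFlat

/-- Left-flatness for TeamCTL: in every subformula `G_∀ ψ` and `[θ M_∃ ψ]`,
the formula `ψ` is an LTL-formula (contains no ⊽). -/
def CTLFormula.leftFlat {AP : Type} : CTLFormula AP → Prop
  | .atom _ => True
  | .natom _ => True
  | .conj φ ψ => φ.leftFlat ∧ ψ.leftFlat
  | .disj φ ψ => φ.leftFlat ∧ ψ.leftFlat
  | .bor φ ψ => φ.leftFlat ∧ ψ.leftFlat
  | .next φ => φ.leftFlat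
  | .globA φ => φ.isFlat
  | .srelE θ ψ => ψ.isFlat ∧ θ.leftFlat

/-- The translation from TeamCTL(X, G_∀, M_∃, ⊽) to TeamLTL(⊽): `G_∀` becomes `G` and
`[θ M_∃ ψ]` becomes `[θ M ψ] = [ψ U (ψ ∧ θ)]`. -/
def CTLFormula.toLTL {AP : Type} : CTLFormula AP → Formula AP
  | .atom p => .atom p
  | .natom p => .natom p
  | .conj φ ψ => .conj φ.toLTL ψ.toLTL
  | .disj φ ψ => .disj φ.toLTL ψ.toLTL
  | .bor φ ψ => .bor φ.toLTL ψ.toLTL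
  | .next φ => .next φ.toLTL
  | .globA φ => .glob φ.toLTL
  | .srelE θ ψ => .untl ψ.toLTL (.conj ψ.toLTL θ.toLTL)

end TeamLTL

namespace TeamLTL

/-- Along an initial tef, no component has advanced further than the number of steps. -/
lemma IsInitialTef.le {ι AP : Type} {T : MultiTeam ι AP} {τ : ℕ → ι × Trace AP → ℕ}
    (h : IsInitialTef T τ) {x : ι × Trace AP} (hx : x ∈ T) (n : ℕ) : τ n x ≤ n := by
  induction n with
  | zero => exact (h.2 x hx).le
  | succ n ih => rcases h.1.1 n x hx with h' | h' <;> omega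

/-- Over infinite teams, asynchronous until and TeamCTL's `U_∃` differ: with
`t_k = {p}^k{q}^ω`, the team `{t_k : k ∈ ℕ}` satisfies `p U q` under lax
asynchronous team semantics, but the multiteam `{(k, t_k) : k ∈ ℕ}` does not
satisfy `[p U_∃ q]` under TeamCTL semantics. -/
theorem until_and_untilE_differ_on_infinite_teams {AP : Type} (p q : AP)
    (hpq : p ≠ q) (tr : ℕ → Trace AP)
    (htr : ∀ k i, (i < k → tr k i = {p}) ∧ (k ≤ i → tr k i = {q})) :
    laxSat (Formula.untl (.atom p) (.atom q)) ({ t | ∃ k, t = tr k } : Team AP) ∧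
    ¬ ∃ τ : ℕ → ℕ × Trace AP → ℕ,
        IsInitialTef ({ x | ∃ k, x = (k, tr k) } : MultiTeam ℕ AP) τ ∧
        ∃ k : ℕ,
          (∀ x ∈ MultiTeam.update { x | ∃ k, x = (k, tr k) } (τ k), q ∈ x.2 0) ∧
          ∀ m < k,
            ∀ x ∈ MultiTeam.update { x | ∃ k, x = (k, tr k) } (τ m), p ∈ x.2 0 := by
  have hq : ∀ k i, q ∈ tr k i ↔ k ≤ i := fun k i => by
    rcases lt_or_ge i k with h | h
    · simp [(htr k i).1 h, hpq.symm, h]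
    · simp [(htr k i).2 h, h]
  have hp : ∀ k i, i < k → p ∈ tr k i := fun k i h => by simp [(htr k i).1 h]
  have hf : ∀ k, {i | IsLeast {j | q ∈ tr k j} i} = ({k} : Set ℕ) := fun k => by
    have hk : {j | q ∈ tr k j} = Set.Ici k := Set.ext (hq k)
    ext i
    rw [hk]
    exact ⟨fun h => h.unique isLeast_Ici, fun h => h ▸ isLeast_Ici⟩
  refine ⟨⟨fun t => {i | IsLeast {j | q ∈ t j} i}, ?_, ?_, Or.inr ?_⟩, ?_⟩
  · rintro _ ⟨k, rfl⟩
    simp only [hf, Set.singleton_nonempty]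
  · rintro _ ⟨_, -, i, hi, rfl⟩
    exact hi.1
  · rintro f' - hlt _ ⟨_, ⟨⟨k, rfl⟩, hk⟩, i, hi, rfl⟩
    obtain ⟨m, hm, hmk⟩ :=
      (hlt (tr k) ⟨⟨k, rfl⟩, hk⟩).2 k (by simp only [hf, isGreatest_singleton])
    exact hp k i ((hm.2 hi).trans_lt hmk)
  · rintro ⟨τ, hτ, k, hk, -⟩
    have hle := hτ.le (x := (k + 1, tr (k + 1))) ⟨k + 1, rfl⟩ k
    have hge := (hq (k + 1) (τ k (k + 1, tr (k + 1)))).1 (hk _ ⟨_, ⟨k + 1, rfl⟩, rfl⟩)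
    omega

end TeamLTL
end
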